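/- arXiv:1512.05058 — 2 statements merged into one kernel-verified Lean document; each statement's English description precedes it below -/
import Mathlib

section
/- Suppose the noises ξ_i(t) (1 ≤ i ≤ n, t ≥ 1) satisfy P(|ξ_i(t)| ≤ ε/2) = 1 for all i, t. If almost surely there exists a finite (random) time T ≥ 0 such that d_V(T) ≤ ε, then almost surely d_V(t) ≤ ε for all t ≥ T; in particular d_V = limsup_{t→∞} d_V(t) ≤ ε almost surely. -/
open MeasureTheory ProbabilityTheory Filter

noncomputable def clip (y : ℝ) : ℝ := min (max y 0) 1

noncomputable def nbr {n : ℕ} (ε : ℝ) (x : Fin n → ℝ) (i : Fin n) : Finset (Fin n) :=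
  Finset.univ.filter (fun j => |x j - x i| ≤ ε)

noncomputable def locAvg {n : ℕ} (ε : ℝ) (x : Fin n → ℝ) (i : Fin n) : ℝ :=
  (∑ j ∈ nbr ε x i, x j) / ((nbr ε x i).card : ℝ)

noncomputable def hkStep {n : ℕ} (ε : ℝ) (x ξ : Fin n → ℝ) (i : Fin n) : ℝ :=
  clip (locAvg ε x i + ξ i)

noncomputable def dV {n : ℕ} (x : Fin n → ℝ) : ℝ := ⨆ i, ⨆ j, |x i - x j|

noncomputable def hkX {Ω : Type*} {n : ℕ} (ε : ℝ) (x0 : Fin n → ℝ)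
    (ξ : Fin n → ℕ → Ω → ℝ) (ω : Ω) : ℕ → Fin n → ℝ
  | 0 => x0
  | t + 1 => hkStep ε (hkX ε x0 ξ ω t) (fun i => ξ i (t + 1) ω)

theorem dV_nonneg {n : ℕ} (x : Fin n → ℝ) : 0 ≤ dV x :=
  Real.iSup_nonneg fun _ => Real.iSup_nonneg fun _ => abs_nonneg _

theorem abs_sub_le_dV {n : ℕ} (x : Fin n → ℝ) (i j : Fin n) : |x i - x j| ≤ dV x :=
  (le_ciSup (Set.finite_range fun j => |x i - x j|).bddAbove j).trans
    (le_ciSup (Set.finite_range fun i => ⨆ j, |x i - x j|).bddAbove i)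

theorem dV_le {n : ℕ} {x : Fin n → ℝ} {c : ℝ} (hc : 0 ≤ c) (h : ∀ i j, |x i - x j| ≤ c) :
    dV x ≤ c :=
  Real.iSup_le (fun i => Real.iSup_le (h i) hc) hc

theorem abs_clip_sub_clip_le (a b : ℝ) : |clip a - clip b| ≤ |a - b| := by
  have h := abs_min_sub_min_le_max (max a 0) 1 (max b 0) 1
  rw [sub_self, abs_zero, max_eq_left (abs_nonneg (max a 0 - max b 0))] at h
  exact h.trans (abs_max_sub_max_le_abs a b 0)

theorem nbr_eq_univ {n : ℕ} {ε : ℝ} {x : Fin n → ℝ} (h : dV x ≤ ε) (i : Fin n) :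
    nbr ε x i = Finset.univ :=
  Finset.filter_true_of_mem fun j _ => (abs_sub_le_dV x j i).trans h

theorem dV_hkStep_le {n : ℕ} {ε : ℝ} (hε : 0 ≤ ε) {x ξ : Fin n → ℝ} (hx : dV x ≤ ε)
    (hξ : ∀ i, |ξ i| ≤ ε / 2) : dV (hkStep ε x ξ) ≤ ε := by
  refine dV_le hε fun i j => (abs_clip_sub_clip_le _ _).trans ?_
  simp only [locAvg, nbr_eq_univ hx, add_sub_add_left_eq_sub]
  linarith [abs_sub (ξ i) (ξ j), hξ i, hξ j]

/-- Lemma 2: if the noises satisfy `P(|ξᵢ(t)| ≤ ε/2) = 1` and almost surely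
there is a finite time T with `d_V(T) ≤ ε`, then almost surely `d_V(t) ≤ ε`
for all t ≥ T; in particular `limsup_t d_V(t) ≤ ε` almost surely. -/
theorem noisyHK_quasiConsensus_absorbing
    {Ω : Type*} [MeasurableSpace Ω] (μ : Measure Ω) [IsProbabilityMeasure μ]
    {n : ℕ} (hn : 1 ≤ n) (ε : ℝ) (hε : ε ∈ Set.Ioc (0 : ℝ) 1)
    (ξ : Fin n → ℕ → Ω → ℝ)
    (hbound : ∀ (i : Fin n) (t : ℕ), ∀ᵐ ω ∂μ, |ξ i (t + 1) ω| ≤ ε / 2)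
    (x0 : Fin n → ℝ) (hx0 : ∀ i, x0 i ∈ Set.Icc (0 : ℝ) 1)
    (T : Ω → ℕ) (hT : ∀ᵐ ω ∂μ, dV (hkX ε x0 ξ ω (T ω)) ≤ ε) :
    (∀ᵐ ω ∂μ, ∀ t, T ω ≤ t → dV (hkX ε x0 ξ ω t) ≤ ε) ∧
      (∀ᵐ ω ∂μ, Filter.atTop.limsup (fun t => dV (hkX ε x0 ξ ω t)) ≤ ε) := by
  have key : ∀ᵐ ω ∂μ, ∀ t, T ω ≤ t → dV (hkX ε x0 ξ ω t) ≤ ε := by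
    filter_upwards [hT, ae_all_iff.2 fun i => ae_all_iff.2 (hbound i)] with ω hω hξ t ht
    induction t, ht using Nat.le_induction with
    | base => exact hω
    | succ t _ ih => exact dV_hkStep_le hε.1.le ih fun i => hξ i t
  refine ⟨key, ?_⟩
  filter_upwards [key] with ω hω
  exact limsup_le_of_le
    (IsBoundedUnder.isCoboundedUnder_le (isBoundedUnder_of ⟨0, fun t => dV_nonneg _⟩))
    (eventually_atTop.2 ⟨T ω, hω⟩)
end

section
/- Let ε ∈ (0, 1/2] and let x ∈ [ε, 1−ε]^n satisfy max_{i,j} |x_i − x_j| ≤ ε, so that every local average equals the global average m = (1/n) ∑_{j=1}^{n} x_j. Let ξ_1,…,ξ_n ∈ ℝ and suppose there exist agents α, β with ξ_α < −ε/2 and ξ_β > ε/2. Define the updated state x'_i = Π(|N(i,x)|^{-1} ∑_{j∈N(i,x)} x_j + ξ_i) with Π(y) = min(max(y,0),1). Then max_{i,j} |x'_i − x'_j| > ε. -/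
open MeasureTheory ProbabilityTheory Filter

theorem lt_clip {a y : ℝ} (ha : a < 1) (hy : a < y) : a < clip y :=
  lt_min (lt_max_of_lt_left hy) ha

theorem clip_lt {a y : ℝ} (ha : 0 < a) (hy : y < a) : clip y < a :=
  min_lt_of_left_lt (max_lt hy ha)

theorem sum_div_mem_Icc {n : ℕ} (hn : 0 < n) {a b : ℝ} {x : Fin n → ℝ}
    (hx : ∀ i, x i ∈ Set.Icc a b) : (∑ j, x j) / (n : ℝ) ∈ Set.Icc a b := by
  have hn' : (0 : ℝ) < n := by exact_mod_cast hn
  have hlow := Finset.card_nsmul_le_sum Finset.univ x a fun i _ => (hx i).1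
  have hupp := Finset.sum_le_card_nsmul Finset.univ x b fun i _ => (hx i).2
  rw [Finset.card_univ, Fintype.card_fin, nsmul_eq_mul, mul_comm] at hlow hupp
  exact ⟨(le_div_iff₀ hn').2 hlow, (div_le_iff₀ hn').2 hupp⟩

/-- One-step separation: if all opinions lie in [ε, 1-ε] within distance ε of
each other (so that each local average equals the global average), and some
agent receives noise below -ε/2 while another receives noise above ε/2, then
after the clipped update the spread exceeds ε. -/
theorem hkStep_dV_gt_of_opposite_noises
    {n : ℕ} (hn : 1 ≤ n) (ε : ℝ) (hε : ε ∈ Set.Ioc (0 : ℝ) (1 / 2))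
    (x : Fin n → ℝ) (hx : ∀ i, x i ∈ Set.Icc ε (1 - ε))
    (hd : ∀ i j : Fin n, |x i - x j| ≤ ε)
    (havg : ∀ i, locAvg ε x i = (∑ j, x j) / (n : ℝ))
    (ξ : Fin n → ℝ) (α β : Fin n)
    (hα : ξ α < -(ε / 2)) (hβ : ε / 2 < ξ β) :
    ∃ i j : Fin n, ε < |hkStep ε x ξ i - hkStep ε x ξ j| := by
  obtain ⟨hε, -⟩ := hε
  obtain ⟨hlow, hupp⟩ := sum_div_mem_Icc hn hx
  set m := (∑ j, x j) / (n : ℝ)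
  have h₁ : hkStep ε x ξ α < m - ε / 2 := by
    rw [hkStep, havg]
    exact clip_lt (by linarith) (by linarith)
  have h₂ : m + ε / 2 < hkStep ε x ξ β := by
    rw [hkStep, havg]
    exact lt_clip (by linarith) (by linarith)
  exact ⟨β, α, lt_abs.2 (Or.inl (by linarith))⟩
end
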